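/- In the metric space with l customers u_1,...,u_l, facilities g_1,...,g_l and f, where d(u_j, g_j) = δ = 1/l, d(u_j, f) = 1, and all other distances are shortest-path distances, the following hold: cost({f}) = l, cost(G) = l·δ = 1 for G = {g_1,...,g_l}, cost({g_i}) = δ + (l−1)(2+δ), and cost(G − g_i + f) = (l−1)δ + 1; consequently cost({g_i})/cost({f}) = 2 − 1/l and cost(G − g_i + f)/cost(G) = 2 − 1/l. -/

import Mathlib

theorem Metric.infDist_eq_of_isMinOn {X : Type*} [PseudoMetricSpace X] {s : Set X} {x y : X}
    {d : ℝ} (hy : y ∈ s) (hd : dist x y = d) (hmin : ∀ z ∈ s, d ≤ dist x z) :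
    Metric.infDist x s = d :=
  le_antisymm (hd ▸ Metric.infDist_le_dist_of_mem hy) ((Metric.le_infDist ⟨y, hy⟩).2 hmin)

theorem Fin.sum_ite_eq_add_mul {l : ℕ} (i : Fin l) (a b : ℝ) :
    ∑ j : Fin l, (if j = i then a else b) = a + (l - 1) * b := by
  have h : ∀ j : Fin l, (if j = i then a else b) = (if j = i then a - b else 0) + b := by
    intro j; split_ifs <;> ring
  simp only [h, Finset.sum_add_distrib, Finset.sum_ite_eq', Finset.mem_univ, if_true,
    Finset.sum_const, Finset.card_univ, Fintype.card_fin, nsmul_eq_mul]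
  ring


/-- The `kl`-median lower-bound instance: `l` customers `u j`, each at distance
`δ = 1/l` from its private facility `g j` and at distance `1` from the common
facility `f`, with all other customer–facility distances being shortest-path
distances (so `d(u j, g i) = 2 + δ` for `i ≠ j`). With
`cost S = ∑_j d(u j, S)` and `G = {g 1, ..., g l}`: `cost {f} = l`,
`cost G = l δ`, `cost {g i} = δ + (l-1)(2+δ)`,
`cost (G - g i + f) = (l-1) δ + 1`; consequently
`cost {g i} / cost {f} = 2 - 1/l` and `cost (G - g i + f) / cost G = 2 - 1/l`. -/
theorem stmt16 {X : Type*} [MetricSpace X] [DecidableEq X] (l : ℕ) (hl : 1 ≤ l)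
    (u g : Fin l → X) (f : X) (δ : ℝ) (hδ : δ = 1 / l)
    (hginj : Function.Injective g)
    (hug : ∀ j, dist (u j) (g j) = δ)
    (huf : ∀ j, dist (u j) f = 1)
    (hcross : ∀ i j, i ≠ j → dist (u j) (g i) = 2 + δ)
    (cost : Finset X → ℝ)
    (hcost : ∀ S, cost S = ∑ j : Fin l, Metric.infDist (u j) (S : Set X))
    (G : Finset X) (hG : G = Finset.univ.image g) :
    cost {f} = l ∧
    cost G = l * δ ∧
    (∀ i, cost {g i} = δ + (l - 1) * (2 + δ)) ∧
    (∀ i, cost ((G \ {g i}) ∪ {f}) = (l - 1) * δ + 1) ∧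
    (∀ i, cost {g i} / cost {f} = 2 - 1 / l) ∧
    (∀ i, cost ((G \ {g i}) ∪ {f}) / cost G = 2 - 1 / l) := by
  have hl1 : (1 : ℝ) ≤ l := by exact_mod_cast hl
  have hl0 : (l : ℝ) ≠ 0 := by positivity
  have hlδ : (l : ℝ) * δ = 1 := by rw [hδ]; field_simp
  have hδ1 : δ ≤ 1 := by rw [hδ]; exact div_le_one_of_le₀ hl1 (by positivity)
  have hug_le : ∀ k j, δ ≤ dist (u j) (g k) := by
    intro k j
    by_cases h : k = j
    · rw [h, hug]
    · rw [hcross k j h]; linarith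
  have cost_f : cost {f} = l := by
    simp [hcost, huf]
  have cost_G : cost G = l * δ := by
    have h : ∀ j, Metric.infDist (u j) (G : Set X) = δ := fun j =>
      Metric.infDist_eq_of_isMinOn (y := g j) (by simp [hG]) (hug j)
        (by simpa [hG] using fun k => hug_le k j)
    simp [hcost, h]
  have cost_g : ∀ i, cost {g i} = δ + (l - 1) * (2 + δ) := by
    intro i
    rw [hcost, ← Fin.sum_ite_eq_add_mul i]
    refine Finset.sum_congr rfl fun j _ => ?_
    rw [Finset.coe_singleton, Metric.infDist_singleton]
    split_ifs with h
    · rw [h, hug]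
    · exact hcross i j (Ne.symm h)
  have cost_swap : ∀ i, cost ((G \ {g i}) ∪ {f}) = (l - 1) * δ + 1 := by
    intro i
    rw [hcost, add_comm, ← Fin.sum_ite_eq_add_mul i]
    refine Finset.sum_congr rfl fun j _ => ?_
    have hmem : ∀ z ∈ (((G \ {g i}) ∪ {f} : Finset X) : Set X), z = f ∨ ∃ k, k ≠ i ∧ z = g k := by
      intro z hz
      simp only [hG, Finset.mem_coe, Finset.mem_union, Finset.mem_sdiff, Finset.mem_image,
        Finset.mem_univ, true_and, Finset.mem_singleton] at hz
      rcases hz with ⟨⟨k, rfl⟩, hk⟩ | hz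
      · exact Or.inr ⟨k, fun h => hk (h ▸ rfl), rfl⟩
      · exact Or.inl hz
    split_ifs with h
    · subst h
      refine Metric.infDist_eq_of_isMinOn (y := f) (by simp) (huf j) fun z hz => ?_
      rcases hmem z hz with rfl | ⟨k, hk, rfl⟩
      · exact (huf j).ge
      · have : 0 ≤ δ := hug j ▸ dist_nonneg
        rw [hcross k j hk]; linarith
    · refine Metric.infDist_eq_of_isMinOn (y := g j) (by simp [hG, hginj.eq_iff, h]) (hug j)
        fun z hz => ?_
      rcases hmem z hz with rfl | ⟨k, -, rfl⟩
      · rw [huf]; exact hδ1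
      · exact hug_le k j
  refine ⟨cost_f, cost_G, cost_g, cost_swap, fun i => ?_, fun i => ?_⟩
  · rw [cost_g, cost_f, hδ]; field_simp; ring
  · rw [cost_swap, cost_G, hlδ, hδ]; field_simp; ring
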